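/- Let T and T′ be positive-weighted trees, each with leaf set [n] and with no vertices of degree 2. If D_{i,j}(T) = D_{i,j}(T′) for all distinct i, j ∈ [n], then there is an isomorphism of weighted trees from T to T′, i.e., a graph isomorphism preserving the lengths of corresponding edges and fixing the labels of the leaves. -/

import Mathlib

/-- A weighted tree whose leaves are labeled bijectively by `Fin n`. -/
structure WeightedTree (n : ℕ) where
  V : Type
  [fintypeV : Fintype V]
  [decEqV : DecidableEq V]
  G : SimpleGraph V
  [decAdj : DecidableRel G.Adj]
  isTree : G.IsTree
  w : Sym2 V → ℝ
  leaf : Fin n → V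
  leaf_inj : Function.Injective leaf
  leaf_iff : ∀ v : V, (∃ i, leaf i = v) ↔ G.degree v ≤ 1

attribute [instance] WeightedTree.fintypeV WeightedTree.decEqV WeightedTree.decAdj

namespace WeightedTree

variable {n : ℕ}

/-- The unique path between two vertices of a tree. -/
noncomputable def treePath (T : WeightedTree n) (u v : T.V) : T.G.Walk u v :=
  (T.isTree.existsUnique_path u v).choose

/-- The sum of the weights of the edges on the path from `u` to `v`. -/
noncomputable def pathWeight (T : WeightedTree n) (u v : T.V) : ℝ :=
  ((T.treePath u v).edges.map T.w).sum

open Classical in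
/-- The total weight of the minimal subtree spanning the leaves indexed by `S`:
the sum of the weights of the edges lying on a path between two leaves of `S`. -/
noncomputable def D (T : WeightedTree n) (S : Finset (Fin n)) : ℝ :=
  ∑ e ∈ T.G.edgeFinset.filter
      (fun e => ∃ i ∈ S, ∃ j ∈ S, e ∈ (T.treePath (T.leaf i) (T.leaf j)).edges),
    T.w e

/-- All edge weights are positive. -/
def PosWeights (T : WeightedTree n) : Prop := ∀ e ∈ T.G.edgeSet, 0 < T.w e

/-- Two leaves are neighbours (form a cherry) if the path between them contains
exactly one vertex of degree at least 3. -/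
def Neighbours (T : WeightedTree n) (a b : Fin n) : Prop :=
  ∃! z : T.V, z ∈ (T.treePath (T.leaf a) (T.leaf b)).support ∧ 3 ≤ T.G.degree z

end WeightedTree

open WeightedTree

/-- An isomorphism of weighted trees: a graph isomorphism which preserves the
lengths of corresponding edges and fixes the labels of the leaves. -/
def WeightedTreeIso {n : ℕ} (T T' : WeightedTree n) : Prop :=
  ∃ φ : T.G ≃g T'.G,
    (∀ e ∈ T.G.edgeSet, T'.w (Sym2.map φ e) = T.w e) ∧
    ∀ i : Fin n, φ (T.leaf i) = T'.leaf i

namespace WeightedTree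

variable {n : ℕ} (T : WeightedTree n)

lemma treePath_isPath (u v : T.V) : (T.treePath u v).IsPath :=
  (T.isTree.existsUnique_path u v).choose_spec.1

lemma eq_treePath {u v : T.V} {p : T.G.Walk u v} (hp : p.IsPath) : p = T.treePath u v :=
  (T.isTree.existsUnique_path u v).choose_spec.2 p hp

lemma pathWeight_eq {u v : T.V} {p : T.G.Walk u v} (hp : p.IsPath) :
    T.pathWeight u v = (p.edges.map T.w).sum := by
  rw [pathWeight, ← T.eq_treePath hp]

@[simp]
lemma pathWeight_self (u : T.V) : T.pathWeight u u = 0 := by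
  simp [T.pathWeight_eq (SimpleGraph.Walk.IsPath.nil (u := u))]

lemma pathWeight_comm (u v : T.V) : T.pathWeight u v = T.pathWeight v u := by
  rw [T.pathWeight_eq (T.treePath_isPath v u).reverse, SimpleGraph.Walk.edges_reverse,
    List.map_reverse, List.sum_reverse, pathWeight]

lemma D_pair (i j : Fin n) :
    T.D {i, j} = T.pathWeight (T.leaf i) (T.leaf j) := by
  classical
  have hnil (u : T.V) : (T.treePath u u).edges = [] := by
    rw [← T.eq_treePath (SimpleGraph.Walk.IsPath.nil (u := u))]
    rfl
  have hrev : (T.treePath (T.leaf j) (T.leaf i)).edges =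
      (T.treePath (T.leaf i) (T.leaf j)).edges.reverse := by
    rw [← T.eq_treePath (T.treePath_isPath (T.leaf i) (T.leaf j)).reverse,
      SimpleGraph.Walk.edges_reverse]
  have hfilter : T.G.edgeFinset.filter
      (fun e => ∃ a ∈ ({i, j} : Finset (Fin n)), ∃ b ∈ ({i, j} : Finset (Fin n)),
        e ∈ (T.treePath (T.leaf a) (T.leaf b)).edges) =
      (T.treePath (T.leaf i) (T.leaf j)).edges.toFinset := by
    ext e
    have := (T.treePath (T.leaf i) (T.leaf j)).edges_subset_edgeSet (e := e)
    simp only [Finset.mem_filter, SimpleGraph.mem_edgeFinset, Finset.mem_insert,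
      Finset.mem_singleton, exists_eq_or_imp, exists_eq_left, hnil, hrev, List.mem_toFinset,
      List.mem_reverse, List.not_mem_nil]
    tauto
  rw [D, pathWeight, ← List.sum_toFinset _ (T.treePath_isPath _ _).isTrail.edges_nodup]
  exact Finset.sum_congr (by convert hfilter) fun _ _ => rfl

/-- Of the two endpoints of an edge, one lies on the path from the other to a given vertex. -/
lemma treePath_eq_cons_or {x y : T.V} (h : T.G.Adj x y) (q : T.V) :
    T.treePath x q = .cons h (T.treePath y q) ∨
      T.treePath y q = .cons h.symm (T.treePath x q) := by
  by_cases hx : x ∈ (T.treePath y q).support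
  · by_cases hy : y ∈ (T.treePath x q).support
    · have key {a b : T.V} (hab : a ≠ b) (ha : a ∈ (T.treePath b q).support) :
          (T.treePath a q).length < (T.treePath b q).length := by
        have h1 := T.eq_treePath ((T.treePath_isPath b q).dropUntil ha)
        have h2 := congrArg SimpleGraph.Walk.length ((T.treePath b q).take_spec ha)
        rw [SimpleGraph.Walk.length_append, h1] at h2
        have h3 : ((T.treePath b q).takeUntil a ha).length ≠ 0 := fun h0 =>
          hab (SimpleGraph.Walk.eq_of_length_eq_zero h0).symm
        omega
      have h1 := key h.ne hx
      have h2 := key h.ne.symm hy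
      omega
    · exact .inr (T.eq_treePath ((T.treePath_isPath x q).cons hy)).symm
  · exact .inl (T.eq_treePath ((T.treePath_isPath y q).cons hx)).symm

lemma pathWeight_of_treePath_eq_cons {x y q : T.V} (h : T.G.Adj x y)
    (hp : T.treePath x q = .cons h (T.treePath y q)) :
    T.pathWeight x q = T.w s(x, y) + T.pathWeight y q := by
  simp [pathWeight, hp]

lemma pathWeight_step {x y : T.V} (h : T.G.Adj x y) (q : T.V) :
    T.pathWeight x q = T.w s(x, y) + T.pathWeight y q ∨
      T.pathWeight y q = T.w s(x, y) + T.pathWeight x q := by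
  refine (T.treePath_eq_cons_or h q).imp (T.pathWeight_of_treePath_eq_cons h) fun hp => ?_
  rw [T.pathWeight_of_treePath_eq_cons h.symm hp, Sym2.eq_swap]

lemma pathWeight_adj {x y : T.V} (h : T.G.Adj x y) : T.pathWeight x y = T.w s(x, y) := by
  simp [T.pathWeight_eq (SimpleGraph.Walk.IsPath.nil.cons (h := h) (by simpa using h.ne))]

/-- A path between distinct vertices starts with an edge towards its end. -/
lemma exists_adj_pathWeight {u v : T.V} (huv : u ≠ v) :
    ∃ z, T.G.Adj u z ∧ T.pathWeight u v = T.w s(u, z) + T.pathWeight z v := by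
  have hp := T.treePath_isPath u v
  cases hP : T.treePath u v with
  | nil => exact absurd rfl huv
  | @cons _ z _ h p =>
    rw [hP] at hp
    exact ⟨z, h, by simp [T.pathWeight_eq hp, T.pathWeight_eq hp.of_cons]⟩

/-- The vertex `v` lies between `u` and `x` for the path metric. -/
def Between (u v x : T.V) : Prop := T.pathWeight u x = T.pathWeight u v + T.pathWeight v x

/-- At least two of the paths from a given vertex to `i`, `j`, `k` pass through `v`. -/
def IsMedian (v i j k : T.V) : Prop :=
  ∀ l, (T.Between l v i ∧ T.Between l v j) ∨ (T.Between l v i ∧ T.Between l v k) ∨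
    (T.Between l v j ∧ T.Between l v k)

variable {T}

lemma PosWeights.adj_pos (hT : T.PosWeights) {x y : T.V} (h : T.G.Adj x y) :
    0 < T.w s(x, y) := hT _ h

lemma PosWeights.pathWeight_nonneg (hT : T.PosWeights) (u v : T.V) : 0 ≤ T.pathWeight u v := by
  refine List.sum_nonneg fun a ha => ?_
  obtain ⟨e, he, rfl⟩ := List.mem_map.1 ha
  exact (hT e ((T.treePath u v).edges_subset_edgeSet he)).le

lemma PosWeights.eq_of_pathWeight_eq_zero (hT : T.PosWeights) {u v : T.V}
    (h : T.pathWeight u v = 0) : u = v := by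
  by_contra huv
  obtain ⟨z, hz, hw⟩ := T.exists_adj_pathWeight huv
  linarith [hT.adj_pos hz, hT.pathWeight_nonneg z v]

lemma PosWeights.pathWeight_triangle (hT : T.PosWeights) (u v x : T.V) :
    T.pathWeight u x ≤ T.pathWeight u v + T.pathWeight v x := by
  have key {a b : T.V} (p : T.G.Walk a b) :
      T.pathWeight a x ≤ (p.edges.map T.w).sum + T.pathWeight b x := by
    induction p with
    | nil => simp
    | @cons a c b h p ih =>
      simp only [SimpleGraph.Walk.edges_cons, List.map_cons, List.sum_cons]
      rcases T.pathWeight_step h x with h' | h' <;> linarith [hT.adj_pos h]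
  exact key (T.treePath u v)

/-- There is at most one edge at a vertex `y` towards a given vertex `q`. -/
lemma PosWeights.adj_towards_unique (hT : T.PosWeights) {x y z q : T.V}
    (hx : T.G.Adj y x) (hz : T.G.Adj y z)
    (hxq : T.pathWeight y q = T.w s(y, x) + T.pathWeight x q)
    (hzq : T.pathWeight y q = T.w s(y, z) + T.pathWeight z q) : x = z := by
  have key {a : T.V} (ha : T.G.Adj y a)
      (haq : T.pathWeight y q = T.w s(y, a) + T.pathWeight a q) :
      T.treePath y q = .cons ha (T.treePath a q) := by
    refine (T.treePath_eq_cons_or ha q).resolve_right fun h => ?_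
    have := T.pathWeight_of_treePath_eq_cons ha.symm h
    rw [Sym2.eq_swap] at this
    linarith [hT.adj_pos ha]
  have h := (key hx hxq).symm.trans (key hz hzq)
  injection h

/-- Once a path leads away from `q`, it keeps doing so. -/
lemma PosWeights.pathWeight_of_away (hT : T.PosWeights) {q y p : T.V} (W : T.G.Walk y p)
    (hW : W.IsPath) (haway : ∀ z ∈ W.support, T.G.Adj y z →
      T.pathWeight z q = T.w s(y, z) + T.pathWeight y q) :
    T.pathWeight p q = (W.edges.map T.w).sum + T.pathWeight y q := by
  induction W with
  | nil => simp
  | @cons y x p h W ih =>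
    have hx := haway x (by simp) h
    have := ih hW.of_cons fun z hz hxz => ?_
    · simp only [SimpleGraph.Walk.edges_cons, List.map_cons, List.sum_cons]
      linarith
    · refine (T.pathWeight_step hxz q).resolve_left fun hzq => ?_
      have hyz : y = z := hT.adj_towards_unique h.symm hxz (by rw [hx, Sym2.eq_swap]) hzq
      subst hyz
      exact (SimpleGraph.Walk.cons_isPath_iff _ _).1 hW |>.2 hz

/-- If `v` is not between `l` and `x`, then `l` and `x` lie in the same direction from `v`. -/
lemma PosWeights.exists_common_direction (hT : T.PosWeights) {l v x : T.V}
    (h : ¬ T.Between l v x) : ∃ z, T.G.Adj v z ∧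
      T.pathWeight v l = T.w s(v, z) + T.pathWeight z l ∧
      T.pathWeight v x = T.w s(v, z) + T.pathWeight z x := by
  by_contra! hne
  have hvl : v ≠ l := by
    rintro rfl
    simp [Between] at h
  refine h ?_
  have key := hT.pathWeight_of_away (q := l) (T.treePath v x) (T.treePath_isPath v x)
    fun z hz hvz => ?_
  · rw [Between, T.pathWeight_comm l x, T.pathWeight_comm l v, key, add_comm, ← pathWeight]
  · refine (T.pathWeight_step hvz l).resolve_left fun hzl => hne z hvz hzl ?_
    have h1 := T.eq_treePath ((T.treePath_isPath v x).dropUntil hz)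
    have h2 := T.eq_treePath ((T.treePath_isPath v x).takeUntil hz)
    have h3 := (T.treePath v x).take_spec hz
    rw [h1, h2] at h3
    rw [← T.pathWeight_adj hvz, pathWeight, ← h3]
    simp [pathWeight]

lemma PosWeights.exists_isMedian (hT : T.PosWeights) (i j k : T.V) :
    ∃ v, T.IsMedian v i j k := by
  have : Nonempty T.V := ⟨i⟩
  obtain ⟨v, hv⟩ := Finite.exists_min
    fun v => T.pathWeight v i + T.pathWeight v j + T.pathWeight v k
  refine ⟨v, fun l => ?_⟩
  have key {x y : T.V} (hxy : ∀ z, T.G.Adj v z →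
      T.pathWeight v x = T.w s(v, z) + T.pathWeight z x →
      T.pathWeight v y = T.w s(v, z) + T.pathWeight z y → False) :
      T.Between l v x ∨ T.Between l v y := by
    by_contra! hn
    obtain ⟨z, hz, hzl, hzx⟩ := hT.exists_common_direction hn.1
    obtain ⟨z', hz', hzl', hzy⟩ := hT.exists_common_direction hn.2
    obtain rfl := hT.adj_towards_unique hz hz' hzl hzl'
    exact hxy z hz hzx hzy
  have hij : T.Between l v i ∨ T.Between l v j := key fun z hz h1 h2 => by
    rcases T.pathWeight_step hz k with h | h <;> linarith [hv z, hT.adj_pos hz]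
  have hik : T.Between l v i ∨ T.Between l v k := key fun z hz h1 h2 => by
    rcases T.pathWeight_step hz j with h | h <;> linarith [hv z, hT.adj_pos hz]
  have hjk : T.Between l v j ∨ T.Between l v k := key fun z hz h1 h2 => by
    rcases T.pathWeight_step hz i with h | h <;> linarith [hv z, hT.adj_pos hz]
  tauto

lemma exists_leaf_eq_or_two_le_degree (v : T.V) : (∃ i, T.leaf i = v) ∨ 2 ≤ T.G.degree v := by
  rw [T.leaf_iff]
  omega

/-- Every path extends to a leaf. -/
lemma PosWeights.exists_between_leaf (hT : T.PosWeights) (u v : T.V) :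
    ∃ i, T.Between u v (T.leaf i) := by
  have : Nonempty {x // T.Between u v x} := ⟨v, by simp [Between]⟩
  obtain ⟨⟨x, hx⟩, hmax⟩ := Finite.exists_max
    fun x : {x // T.Between u v x} => T.pathWeight u x
  rcases T.exists_leaf_eq_or_two_le_degree x with ⟨i, rfl⟩ | hdeg
  · exact ⟨i, hx⟩
  exfalso
  have hno {z : T.V} (hz : T.G.Adj x z) :
      T.pathWeight x u = T.w s(x, z) + T.pathWeight z u := by
    refine (T.pathWeight_step hz u).resolve_right fun hzu => ?_
    have hxz := T.pathWeight_adj hz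
    have hb : T.Between u v z := by
      unfold Between at hx ⊢
      refine le_antisymm (hT.pathWeight_triangle u v z) ?_
      linarith [hT.pathWeight_triangle v x z, T.pathWeight_comm u x, T.pathWeight_comm u z]
    have := hmax ⟨z, hb⟩
    simp only at this
    linarith [T.pathWeight_comm u x, T.pathWeight_comm u z, hT.adj_pos hz]
  obtain ⟨a, ha, b, hb, hab⟩ := Finset.one_lt_card.1
    (show 1 < (T.G.neighborFinset x).card from hdeg)
  rw [SimpleGraph.mem_neighborFinset] at ha hb
  exact hab (hT.adj_towards_unique ha hb (hno ha) (hno hb))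

/-- Without vertices of degree two, every vertex is a median of leaves. -/
lemma PosWeights.exists_isMedian_leaf (hT : T.PosWeights) (hdeg : ∀ v : T.V, T.G.degree v ≠ 2)
    (v : T.V) : ∃ i j k, T.IsMedian v (T.leaf i) (T.leaf j) (T.leaf k) := by
  rcases T.exists_leaf_eq_or_two_le_degree v with ⟨i, rfl⟩ | h2
  · exact ⟨i, i, i, fun l => by simp [Between]⟩
  have h3 : 2 < (T.G.neighborFinset v).card := lt_of_le_of_ne h2 (hdeg v).symm
  obtain ⟨a, b, c, ha, hb, hc, hab, hac, hbc⟩ := Finset.two_lt_card_iff.1 h3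
  rw [SimpleGraph.mem_neighborFinset] at ha hb hc
  obtain ⟨i, hi⟩ := hT.exists_between_leaf v a
  obtain ⟨j, hj⟩ := hT.exists_between_leaf v b
  obtain ⟨k, hk⟩ := hT.exists_between_leaf v c
  refine ⟨i, j, k, fun l => ?_⟩
  have key {a b x y : T.V} (ha : T.G.Adj v a) (hb : T.G.Adj v b) (hab : a ≠ b)
      (hx : T.Between v a x) (hy : T.Between v b y) : T.Between l v x ∨ T.Between l v y := by
    by_contra! hn
    obtain ⟨z, hz, hzl, hzx⟩ := hT.exists_common_direction hn.1
    obtain ⟨z', hz', hzl', hzy⟩ := hT.exists_common_direction hn.2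
    rw [Between, T.pathWeight_adj ha] at hx
    rw [Between, T.pathWeight_adj hb] at hy
    exact hab ((hT.adj_towards_unique ha hz hx hzx).trans
      ((hT.adj_towards_unique hz hz' hzl hzl').trans (hT.adj_towards_unique hz' hb hzy hy)))
  have hij := key ha hb hab hi hj
  have hik := key ha hc hac hi hk
  have hjk := key hb hc hbc hj hk
  tauto

lemma IsMedian.between {v i j k : T.V} (hT : T.PosWeights) (h : T.IsMedian v i j k) :
    T.Between i v j ∧ T.Between i v k ∧ T.Between j v k := by
  have hself {x y : T.V} (hx : T.Between x v x) : T.Between x v y := by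
    rw [Between, pathWeight_self, T.pathWeight_comm v x] at hx
    have := hT.eq_of_pathWeight_eq_zero (u := x) (v := v) (by linarith)
    simp [Between, this]
  have hsymm {x y : T.V} (hx : T.Between x v y) : T.Between y v x := by
    unfold Between at hx ⊢
    linarith [T.pathWeight_comm x y, T.pathWeight_comm x v, T.pathWeight_comm y v]
  refine ⟨?_, ?_, ?_⟩
  · rcases h i with h | h | h
    · exact h.2
    · exact hself h.1
    · exact h.1
  · rcases h i with h | h | h
    · exact hself h.1
    · exact h.2
    · exact h.2
  · rcases h j with h | h | h
    · exact hself h.2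
    · exact h.2
    · exact h.2

section Comparison

variable {T' : WeightedTree n}

/-- Two vertices of two trees have the same distances to all leaves. -/
def SameLeafDist (v : T.V) (v' : T'.V) : Prop :=
  ∀ l, T.pathWeight v (T.leaf l) = T'.pathWeight v' (T'.leaf l)

lemma SameLeafDist.symm {v : T.V} {v' : T'.V} (h : SameLeafDist v v') : SameLeafDist v' v :=
  fun l => (h l).symm

lemma IsMedian.sameLeafDist (hT : T.PosWeights) (hT' : T'.PosWeights)
    (hd : ∀ i j, T.pathWeight (T.leaf i) (T.leaf j) = T'.pathWeight (T'.leaf i) (T'.leaf j))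
    {v : T.V} {v' : T'.V} {i j k : Fin n} (h : T.IsMedian v (T.leaf i) (T.leaf j) (T.leaf k))
    (h' : T'.IsMedian v' (T'.leaf i) (T'.leaf j) (T'.leaf k)) : SameLeafDist v v' := by
  obtain ⟨h1, h2, h3⟩ := h.between hT
  obtain ⟨h1', h2', h3'⟩ := h'.between hT'
  unfold Between at h1 h2 h3 h1' h2' h3'
  rw [T.pathWeight_comm _ v] at h1 h2 h3
  rw [T'.pathWeight_comm _ v'] at h1' h2' h3'
  rw [hd] at h1 h2 h3
  have hi : T.pathWeight v (T.leaf i) = T'.pathWeight v' (T'.leaf i) := by linarith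
  have hj : T.pathWeight v (T.leaf j) = T'.pathWeight v' (T'.leaf j) := by linarith
  have hk : T.pathWeight v (T.leaf k) = T'.pathWeight v' (T'.leaf k) := by linarith
  intro l
  have e1 := T.pathWeight_comm v (T.leaf l)
  have e2 := T'.pathWeight_comm v' (T'.leaf l)
  apply le_antisymm
  · have key {x : Fin n} (hx : T.pathWeight v (T.leaf x) = T'.pathWeight v' (T'.leaf x))
        (hb : T.Between (T.leaf l) v (T.leaf x)) :
        T.pathWeight v (T.leaf l) ≤ T'.pathWeight v' (T'.leaf l) := by
      unfold Between at hb
      linarith [hT'.pathWeight_triangle (T'.leaf l) v' (T'.leaf x), hd l x]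
    rcases h (T.leaf l) with h | h | h
    exacts [key hi h.1, key hi h.1, key hj h.1]
  · have key {x : Fin n} (hx : T.pathWeight v (T.leaf x) = T'.pathWeight v' (T'.leaf x))
        (hb : T'.Between (T'.leaf l) v' (T'.leaf x)) :
        T'.pathWeight v' (T'.leaf l) ≤ T.pathWeight v (T.leaf l) := by
      unfold Between at hb
      linarith [hT.pathWeight_triangle (T.leaf l) v (T.leaf x), hd l x]
    rcases h' (T'.leaf l) with h | h | h
    exacts [key hi h.1, key hi h.1, key hj h.1]

lemma exists_sameLeafDist (hT : T.PosWeights) (hT' : T'.PosWeights)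
    (hdeg : ∀ v : T.V, T.G.degree v ≠ 2)
    (hd : ∀ i j, T.pathWeight (T.leaf i) (T.leaf j) = T'.pathWeight (T'.leaf i) (T'.leaf j))
    (v : T.V) : ∃ v' : T'.V, SameLeafDist v v' := by
  obtain ⟨i, j, k, h⟩ := hT.exists_isMedian_leaf hdeg v
  obtain ⟨v', h'⟩ := hT'.exists_isMedian (T'.leaf i) (T'.leaf j) (T'.leaf k)
  exact ⟨v', h.sameLeafDist hT hT' hd h'⟩

lemma SameLeafDist.pathWeight_le (hT : T.PosWeights) (hT' : T'.PosWeights) {u v : T.V}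
    {u' v' : T'.V} (hu : SameLeafDist u u') (hv : SameLeafDist v v') :
    T.pathWeight u v ≤ T'.pathWeight u' v' := by
  obtain ⟨l, hl⟩ := hT.exists_between_leaf u v
  unfold Between at hl
  linarith [hu l, hv l, hT'.pathWeight_triangle u' v' (T'.leaf l)]

lemma SameLeafDist.pathWeight_eq (hT : T.PosWeights) (hT' : T'.PosWeights) {u v : T.V}
    {u' v' : T'.V} (hu : SameLeafDist u u') (hv : SameLeafDist v v') :
    T.pathWeight u v = T'.pathWeight u' v' :=
  (hu.pathWeight_le hT hT' hv).antisymm (hu.symm.pathWeight_le hT' hT hv.symm)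

/-- A bijection preserving the path metric preserves adjacency. -/
lemma adj_of_pathWeight_eq (hT : T.PosWeights) (hT' : T'.PosWeights) (f : T.V ≃ T'.V)
    (hf : ∀ u v, T.pathWeight u v = T'.pathWeight (f u) (f v)) {u v : T.V} (h : T.G.Adj u v) :
    T'.G.Adj (f u) (f v) := by
  obtain ⟨z', hz', hw⟩ := T'.exists_adj_pathWeight (f.injective.ne h.ne)
  obtain ⟨z, rfl⟩ := f.surjective z'
  rw [← T'.pathWeight_adj hz', ← hf, ← hf, ← hf] at hw
  have hpos := hT'.adj_pos hz'
  rw [← T'.pathWeight_adj hz', ← hf] at hpos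
  have huv := T.pathWeight_adj h
  have hc := T.pathWeight_comm z v
  rcases T.pathWeight_step h z with hs | hs
  · rwa [← hT.eq_of_pathWeight_eq_zero (u := z) (v := v) (by linarith)]
  · linarith

end Comparison

end WeightedTree

/-- two positive-weighted trees with leaf set `[n]`, no vertices
of degree 2 and the same double weights are isomorphic as weighted trees. -/
theorem tree_determined_by_double_weights (n : ℕ)
    (T T' : WeightedTree n) (hpos : T.PosWeights) (hpos' : T'.PosWeights)
    (hdeg : ∀ v : T.V, T.G.degree v ≠ 2) (hdeg' : ∀ v : T'.V, T'.G.degree v ≠ 2)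
    (hD : ∀ i j : Fin n, i ≠ j → T.D {i, j} = T'.D {i, j}) :
    WeightedTreeIso T T' := by
  have hd (i j : Fin n) :
      T.pathWeight (T.leaf i) (T.leaf j) = T'.pathWeight (T'.leaf i) (T'.leaf j) := by
    rcases eq_or_ne i j with rfl | hij
    · simp
    · rw [← D_pair, ← D_pair, hD i j hij]
  choose f hf using exists_sameLeafDist hpos hpos' hdeg hd
  choose g hg using exists_sameLeafDist hpos' hpos hdeg' fun i j => (hd i j).symm
  let φ : T.V ≃ T'.V :=
    { toFun := f
      invFun := g
      left_inv := fun v => hpos.eq_of_pathWeight_eq_zero <| by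
        rw [(hg (f v)).symm.pathWeight_eq hpos hpos' (hf v), pathWeight_self]
      right_inv := fun v' => hpos'.eq_of_pathWeight_eq_zero <| by
        rw [← (hf (g v')).pathWeight_eq hpos hpos' (hg v').symm, pathWeight_self] }
  have hφ (u v : T.V) : T.pathWeight u v = T'.pathWeight (φ u) (φ v) :=
    (hf u).pathWeight_eq hpos hpos' (hf v)
  have hadj {u v : T.V} (h : T.G.Adj u v) : T'.G.Adj (φ u) (φ v) :=
    adj_of_pathWeight_eq hpos hpos' φ hφ h
  refine ⟨⟨φ, fun {u v} => ⟨fun h => ?_, hadj⟩⟩, fun e he => ?_, fun i => ?_⟩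
  · simpa using adj_of_pathWeight_eq hpos' hpos φ.symm (fun u v => by simp [hφ]) h
  · induction e with
    | h u v =>
      change T'.w s(φ u, φ v) = _
      rw [← T.pathWeight_adj he, ← T'.pathWeight_adj (hadj he), hφ]
  · refine hpos'.eq_of_pathWeight_eq_zero ?_
    change T'.pathWeight (f (T.leaf i)) _ = 0
    rw [← hf (T.leaf i) i, pathWeight_self]
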